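/- Let m ≥ 1 and let x, y be real algebraic numbers each of degree exactly m. Then y − x is algebraic and H(y − x) ≤ 2^{4m²} · H(x)^m · H(y)^m. -/

import Mathlib

open Polynomial

/-- The primitive minimal polynomial over ℤ of a real number. -/
noncomputable def intMinpoly (α : ℝ) : Polynomial ℤ :=
  (IsLocalization.integerNormalization (nonZeroDivisors ℤ) (minpoly ℚ α)).primPart

/-- The height of an algebraic number: the maximum of the absolute values of the
coefficients of its primitive minimal polynomial over ℤ. -/
noncomputable def algHeight (α : ℝ) : ℕ :=
  (intMinpoly α).support.sup fun i => ((intMinpoly α).coeff i).natAbs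

/-- `α` is a real algebraic number of degree exactly `m`. -/
def DegreeExactly (m : ℕ) (α : ℝ) : Prop :=
  IsAlgebraic ℚ α ∧ (minpoly ℚ α).natDegree = m

/-- `exp^[3](x) = e^(e^(e^x))`. -/
noncomputable def expCube (x : ℝ) : ℝ := Real.exp (Real.exp (Real.exp x))

/-- `ξ` is an `m`-ultra number: there is a sequence `(α_n)_{n ≥ 1}` of pairwise distinct
real algebraic numbers of degree exactly `m` with
`0 < |ξ - α_n| < (exp^[3](H(α_n)))^{-n}` for all `n ≥ 1`. Here `a k` plays the
role of `α_{k+1}`. -/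
def IsMUltra (m : ℕ) (ξ : ℝ) : Prop :=
  ∃ a : ℕ → ℝ, Function.Injective a ∧
    ∀ n : ℕ, DegreeExactly m (a n) ∧ 0 < |ξ - a n| ∧
      |ξ - a n| < (expCube (algHeight (a n)))⁻¹ ^ (n + 1)

/-- A function `f : ℝ → ℝ` is transcendental if the only complex two-variable polynomial
`P` with `P (x, f x) = 0` for all real `x` is the zero polynomial. -/
def TranscendentalFun (f : ℝ → ℝ) : Prop :=
  ∀ P : MvPolynomial (Fin 2) ℂ,
    (∀ x : ℝ, MvPolynomial.eval ![(x : ℂ), (f x : ℂ)] P = 0) → P = 0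

open IsLocalization in
lemma intMinpoly_map {α : ℝ} (hα : IsAlgebraic ℚ α) :
    ∃ c : ℚ, c ≠ 0 ∧ (intMinpoly α).map (algebraMap ℤ ℚ) = C c * minpoly ℚ α := by
  set N := integerNormalization (nonZeroDivisors ℤ) (minpoly ℚ α) with hN
  have hN0 : N ≠ 0 := by
    rw [hN, Ne, IsFractionRing.integerNormalization_eq_zero_iff]
    exact minpoly.ne_zero hα.isIntegral
  obtain ⟨b, hb, hbN⟩ := integerNormalization_spec (nonZeroDivisors ℤ) (minpoly ℚ α)
  have hb0 : (b : ℚ) ≠ 0 := by exact_mod_cast nonZeroDivisors.ne_zero hb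
  have hc0 : (N.content : ℚ) ≠ 0 := by exact_mod_cast content_eq_zero_iff.not.mpr hN0
  refine ⟨(N.content : ℚ)⁻¹ * b, mul_ne_zero (inv_ne_zero hc0) hb0, ?_⟩
  rw [← hN, N.eq_C_content_mul_primPart, Polynomial.map_mul, map_C] at hbN
  rw [C_mul, mul_assoc, map_intCast (C : ℚ →+* ℚ[X]) b, ← zsmul_eq_mul, ← hbN, ← mul_assoc]
  rw [← C_mul, algebraMap_int_eq, eq_intCast, inv_mul_cancel₀ hc0, C_1, one_mul, intMinpoly]

lemma intMinpoly_isPrimitive (α : ℝ) : (intMinpoly α).IsPrimitive :=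
  isPrimitive_primPart _

lemma natDegree_intMinpoly {α : ℝ} (hα : IsAlgebraic ℚ α) :
    (intMinpoly α).natDegree = (minpoly ℚ α).natDegree := by
  obtain ⟨c, hc, h⟩ := intMinpoly_map hα
  rw [← natDegree_map_eq_of_injective (algebraMap ℤ ℚ).injective_int, h, natDegree_C_mul hc]

lemma aeval_intMinpoly {α : ℝ} (hα : IsAlgebraic ℚ α) : aeval α (intMinpoly α) = 0 := by
  obtain ⟨c, -, h⟩ := intMinpoly_map hα
  rw [← aeval_map_algebraMap ℚ, h, map_mul, minpoly.aeval, mul_zero]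

lemma intMinpoly_dvd {α : ℝ} (hα : IsAlgebraic ℚ α) {p : ℤ[X]} (hp : aeval α p = 0) :
    intMinpoly α ∣ p := by
  obtain ⟨c, hc, h⟩ := intMinpoly_map hα
  refine (intMinpoly_isPrimitive α).dvd_of_fraction_map_dvd_fraction_map (K := ℚ) ?_
  rw [h, (isUnit_C.mpr hc.isUnit).mul_left_dvd]
  exact minpoly.dvd ℚ _ (by rwa [aeval_map_algebraMap])

lemma abs_coeff_intMinpoly_le (α : ℝ) (i : ℕ) :
    ((intMinpoly α).coeff i).natAbs ≤ algHeight α := by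
  by_cases h : i ∈ (intMinpoly α).support
  · exact Finset.le_sup (f := fun i => ((intMinpoly α).coeff i).natAbs) h
  · simp [notMem_support_iff.mp h]

lemma mahlerMeasure_intMinpoly_le {α : ℝ} {m : ℕ} (hα : DegreeExactly m α) :
    ((intMinpoly α).map (Int.castRingHom ℂ)).mahlerMeasure ≤ 2 ^ m * algHeight α := by
  refine (mahlerMeasure_le_sqrt_natDegree_add_one_mul_supNorm _).trans ?_
  have hdeg : ((intMinpoly α).map (Int.castRingHom ℂ)).natDegree = m := by
    rw [natDegree_map_eq_of_injective (RingHom.injective_int _), natDegree_intMinpoly hα.1, hα.2]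
  rw [hdeg]
  refine mul_le_mul ?_ ?_ (supNorm_nonneg _) (by positivity)
  · rw [Real.sqrt_le_left (by positivity)]
    have h : ((m + 1 : ℕ) : ℝ) ≤ ((2 ^ m : ℕ) : ℝ) := by exact_mod_cast Nat.lt_two_pow_self
    push_cast at h
    nlinarith [one_le_pow₀ (one_le_two (α := ℝ)) (n := m)]
  · obtain ⟨i, hi⟩ := ((intMinpoly α).map (Int.castRingHom ℂ)).exists_eq_supNorm
    rw [hi, coeff_map, eq_intCast, Complex.norm_intCast, ← Int.cast_abs, Int.abs_eq_natAbs]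
    exact_mod_cast abs_coeff_intMinpoly_le α i

lemma mahlerMeasure_taylor_le (q : ℂ[X]) (z : ℂ) :
    (taylor z q).mahlerMeasure ≤ (2 * max 1 ‖z‖) ^ q.natDegree * q.mahlerMeasure := by
  have hs := IsAlgClosed.splits q
  have h : taylor z q = C q.leadingCoeff * (q.roots.map fun w => X - C (w - z)).prod := by
    conv_lhs => rw [hs.eq_prod_roots]
    rw [taylor_mul, taylor_C, ← taylorAlgHom_apply, map_multiset_prod, Multiset.map_map]
    congr 3
    ext1 w
    simp
    ring
  rw [h, mahlerMeasure_mul, prod_mahlerMeasure_eq_mahlerMeasure_prod, Multiset.map_map,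
    mahlerMeasure_eq_leadingCoeff_mul_prod_roots q, mahlerMeasure_const, mul_left_comm,
    hs.natDegree_eq_card_roots]
  gcongr
  rw [← Multiset.prod_replicate, ← Multiset.map_const', ← Multiset.prod_map_mul]
  refine Multiset.prod_map_le_prod_map₀ _ _ (fun w _ => mahlerMeasure_nonneg _) fun w _ => ?_
  simp only [Function.comp_apply, mahlerMeasure_X_sub_C]
  have h1 := norm_sub_le w z
  have h2 := le_max_left 1 ‖w‖
  have h3 := le_max_left 1 ‖z‖
  have h4 := le_max_right 1 ‖w‖
  have h5 := le_max_right 1 ‖z‖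
  refine max_le ?_ ?_ <;> nlinarith

/-- The resultant with respect to `X` of `p(X)` and `q(X + T)`, a polynomial in `T` that vanishes
at all differences of a root of `q` and a root of `p`. -/
noncomputable def diffResultant (p q : ℤ[X]) : ℤ[X] :=
  resultant (p.map C) (taylor X (q.map C)) p.natDegree q.natDegree

lemma diffResultant_map {p q : ℤ[X]} :
    (diffResultant p q).map (Int.castRingHom ℂ) =
      C ((p.leadingCoeff : ℂ) ^ q.natDegree) *
        ((p.map (Int.castRingHom ℂ)).roots.map
          fun z => taylor z (q.map (Int.castRingHom ℂ))).prod := by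
  set φ := Int.castRingHom ℂ
  have hφ : Function.Injective φ := φ.injective_int
  have hp : (p.map C).map (mapRingHom φ) = (p.map φ).map C := by
    simp [Polynomial.map_map, mapRingHom_comp_C]
  have hq : (taylor X (q.map C)).map (mapRingHom φ) = taylor X ((q.map φ).map C) := by
    simp [taylor_apply, Polynomial.map_comp, Polynomial.map_map, mapRingHom_comp_C]
  have hs := IsAlgClosed.splits (p.map φ)
  rw [diffResultant, ← coe_mapRingHom, ← resultant_map_map, hp, hq,
    ← natDegree_map_eq_of_injective hφ p,
    ← natDegree_map_eq_of_injective (C_injective (R := ℂ)) (p.map φ),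
    resultant_eq_prod_eval _ _ _ (by simp [natDegree_map_eq_of_injective hφ]) (hs.map C),
    hs.roots_map_of_injective C_injective, Multiset.map_map,
    leadingCoeff_map_of_injective C_injective, leadingCoeff_map_of_injective hφ]
  congr 1
  · simp [φ]
  · congr 2
    ext1 z
    rw [Function.comp_apply, taylor_eval, eval_map, taylor_apply, add_comm]
    rfl

lemma mahlerMeasure_diffResultant_le (p q : ℤ[X]) :
    ((diffResultant p q).map (Int.castRingHom ℂ)).mahlerMeasure ≤
      2 ^ (p.natDegree * q.natDegree) *
        (p.map (Int.castRingHom ℂ)).mahlerMeasure ^ q.natDegree *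
        (q.map (Int.castRingHom ℂ)).mahlerMeasure ^ p.natDegree := by
  set φ := Int.castRingHom ℂ
  have hφ : Function.Injective φ := φ.injective_int
  have hcard : (p.map φ).roots.card = p.natDegree := by
    rw [← (IsAlgClosed.splits _).natDegree_eq_card_roots, natDegree_map_eq_of_injective hφ]
  rw [diffResultant_map, mahlerMeasure_mul, prod_mahlerMeasure_eq_mahlerMeasure_prod,
    Multiset.map_map, mahlerMeasure_const]
  calc _ ≤ ‖(p.leadingCoeff : ℂ) ^ q.natDegree‖ * ((p.map φ).roots.map fun z =>
        (2 * max 1 ‖z‖) ^ q.natDegree * (q.map φ).mahlerMeasure).prod := by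
        gcongr
        refine Multiset.prod_map_le_prod_map₀ _ _ (fun w _ => mahlerMeasure_nonneg _) fun w _ => ?_
        simpa [natDegree_map_eq_of_injective hφ] using mahlerMeasure_taylor_le (q.map φ) w
    _ = _ := by
        rw [Multiset.prod_map_mul, Multiset.prod_map_pow, Multiset.prod_map_mul,
          mahlerMeasure_eq_leadingCoeff_mul_prod_roots (p.map φ),
          leadingCoeff_map_of_injective hφ]
        simp [hcard, φ]
        ring

lemma diffResultant_ne_zero {p q : ℤ[X]} (hp : p ≠ 0) (hq : q ≠ 0) : diffResultant p q ≠ 0 := by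
  have hφ : Function.Injective (Int.castRingHom ℂ) := RingHom.injective_int _
  rw [← (Polynomial.map_injective _ hφ).ne_iff, diffResultant_map]
  simp [hp, taylor_eq_zero, Polynomial.map_eq_zero_iff hφ, hq]

lemma natDegree_diffResultant_le (p q : ℤ[X]) :
    (diffResultant p q).natDegree ≤ p.natDegree * q.natDegree := by
  have hφ : Function.Injective (Int.castRingHom ℂ) := RingHom.injective_int _
  rw [← natDegree_map_eq_of_injective hφ, diffResultant_map]
  refine (natDegree_C_mul_le _ _).trans ((natDegree_multiset_prod_le _).trans ?_)
  simp [Multiset.map_map, natDegree_map_eq_of_injective hφ,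
    ← (IsAlgClosed.splits _).natDegree_eq_card_roots]

lemma aeval_sub_diffResultant {p q : ℤ[X]} (hp : p ≠ 0) {x y : ℝ} (hx : aeval x p = 0)
    (hy : aeval y q = 0) : aeval (y - x) (diffResultant p q) = 0 := by
  have hφ : Function.Injective (Int.castRingHom ℂ) := RingHom.injective_int _
  have hx' : aeval (x : ℂ) p = 0 := by
    simpa [hx] using aeval_algebraMap_apply ℂ x p
  have hy' : aeval (y : ℂ) q = 0 := by
    simpa [hy] using aeval_algebraMap_apply ℂ y q
  have hmem : (x : ℂ) ∈ (p.map (Int.castRingHom ℂ)).roots := by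
    rw [mem_roots ((Polynomial.map_ne_zero_iff hφ).mpr hp)]
    simpa [IsRoot, aeval_def, eval_map] using hx'
  have h : aeval ((y - x : ℝ) : ℂ) (diffResultant p q) = 0 := by
    rw [← eval_map_algebraMap, algebraMap_int_eq, diffResultant_map, eval_mul, eval_multiset_prod,
      Multiset.map_map, Multiset.prod_eq_zero (Multiset.mem_map.mpr ⟨_, hmem, ?_⟩), mul_zero]
    simpa [taylor_eval, aeval_def, eval_map] using hy'
  have h' := aeval_algebraMap_apply ℂ (y - x) (diffResultant p q)
  exact Complex.ofReal_eq_zero.mp (h'.symm.trans h)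

/-- If `x, y` are real algebraic numbers of degree exactly `m`, then `y - x` is
algebraic and `H(y - x) ≤ 2^(4m²) · H(x)^m · H(y)^m`. -/
theorem stmt_10 (m : ℕ) (hm : 1 ≤ m) (x y : ℝ)
    (hx : DegreeExactly m x) (hy : DegreeExactly m y) :
    IsAlgebraic ℚ (y - x) ∧
      algHeight (y - x) ≤ 2 ^ (4 * m ^ 2) * algHeight x ^ m * algHeight y ^ m := by
  have halg : IsAlgebraic ℚ (y - x) := hy.1.sub hx.1
  refine ⟨halg, Finset.sup_le fun i _ => ?_⟩
  have hpx : intMinpoly x ≠ 0 := (intMinpoly_isPrimitive x).ne_zero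
  have hpy : intMinpoly y ≠ 0 := (intMinpoly_isPrimitive y).ne_zero
  have hdx : (intMinpoly x).natDegree = m := (natDegree_intMinpoly hx.1).trans hx.2
  have hdy : (intMinpoly y).natDegree = m := (natDegree_intMinpoly hy.1).trans hy.2
  have hr0 := diffResultant_ne_zero hpx hpy
  have hle := natDegree_diffResultant_le (intMinpoly x) (intMinpoly y)
  have hM := mahlerMeasure_diffResultant_le (intMinpoly x) (intMinpoly y)
  obtain ⟨g, hg⟩ := intMinpoly_dvd halg (aeval_sub_diffResultant hpx
    (aeval_intMinpoly hx.1) (aeval_intMinpoly hy.1))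
  have hg0 : g ≠ 0 := right_ne_zero_of_mul (hg ▸ hr0)
  have hd : (intMinpoly (y - x)).natDegree ≤ m * m := by
    rw [hdx, hdy] at hle
    exact (natDegree_le_of_dvd ⟨g, hg⟩ hr0).trans hle
  have hcoeff := norm_coeff_le_choose_mul_mahlerMeasure_of_one_le_mahlerMeasure i
    ((intMinpoly (y - x)).map (Int.castRingHom ℂ)) _ (one_le_mahlerMeasure_of_ne_zero hg0)
  rw [← Polynomial.map_mul, ← hg, natDegree_map_eq_of_injective (RingHom.injective_int _),
    coeff_map, eq_intCast, Complex.norm_intCast, ← Int.cast_abs, Int.abs_eq_natAbs] at hcoeff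
  have hchoose : (((intMinpoly (y - x)).natDegree.choose i : ℕ) : ℝ) ≤ 2 ^ (m * m) := by
    exact_mod_cast (Nat.choose_le_two_pow _ _).trans (Nat.pow_le_pow_right two_pos hd)
  rw [hdx, hdy] at hM
  have key : ((((intMinpoly (y - x)).coeff i).natAbs : ℕ) : ℝ) ≤
      2 ^ (4 * m ^ 2) * (algHeight x : ℝ) ^ m * (algHeight y : ℝ) ^ m := by
    calc _ ≤ _ := hcoeff
      _ ≤ 2 ^ (m * m) * (2 ^ (m * m) * (2 ^ m * (algHeight x : ℝ)) ^ m *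
          (2 ^ m * (algHeight y : ℝ)) ^ m) := by
        refine mul_le_mul hchoose (hM.trans ?_) (mahlerMeasure_nonneg _) (by positivity)
        gcongr
        · exact pow_nonneg (mahlerMeasure_nonneg _) _
        · exact mahlerMeasure_nonneg _
        · exact mahlerMeasure_intMinpoly_le hx
        · exact mahlerMeasure_nonneg _
        · exact mahlerMeasure_intMinpoly_le hy
      _ = _ := by
        ring
  exact_mod_cast key
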